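/- Let f be a twist map with normalized lift f̃, let φ > 0, and suppose 0 is a regular value of F_φ viewed as a C¹ function on A (i.e. DF_φ(p) ≠ 0 at every p with F_φ(p) = 0). Then the zero set Z = F_φ⁻¹(0) ⊆ A is a compact set disjoint from both boundary circles of A, Z has only finitely many connected components, and each connected component of Z is homeomorphic to the unit circle. -/

import Mathlib

open Set MeasureTheory

noncomputable section

/-- The cylinder `(ℝ/ℤ) × ℝ`, in which the standard annulus sits. -/
abbrev Cyl : Type := AddCircle (1 : ℝ) × ℝ

/-- The standard annulus `A = (ℝ/ℤ) × [0,1]`, viewed inside the cylinder. -/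
def annA : Set Cyl := Set.univ ×ˢ Set.Icc (0 : ℝ) 1

/-- The universal cover `Ã = ℝ × [0,1]`, viewed inside `ℝ²`. -/
def stripA : Set (ℝ × ℝ) := Set.univ ×ˢ Set.Icc (0 : ℝ) 1

/-- The covering projection `π(x, y) = (x mod 1, y)`. -/
def covProj (p : ℝ × ℝ) : Cyl := ((p.1 : AddCircle (1 : ℝ)), p.2)

/-- `F_φ(x,y) = φ·(f̃₁(x,y) − x) − (f̃₂(x,y) − y)`, for a lift `F = f̃`. -/
def Fphi (F : ℝ × ℝ → ℝ × ℝ) (φ : ℝ) (p : ℝ × ℝ) : ℝ :=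
  φ * ((F p).1 - p.1) - ((F p).2 - p.2)

/-- Since `F_φ` is 1-periodic in `x`, it descends to `A`; this is the zero set
`Z = F_φ⁻¹(0) ⊆ A` of the descended function. -/
def zeroSetA (F : ℝ × ℝ → ℝ × ℝ) (φ : ℝ) : Set Cyl :=
  covProj '' {p ∈ stripA | Fphi F φ p = 0}

open Filter Topology

theorem local_hom_ext {G : Type*} [Monoid G] (ψ : ℝ → G) (ε : ℝ) (hε : 0 < ε) (h0 : ψ 0 = 1)
    (h : ∀ s t, |s| < ε → |t| < ε → |s + t| < ε → ψ (s + t) = ψ s * ψ t) :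
    ∃ Φ : ℝ → G, (∀ s t, Φ (s + t) = Φ s * Φ t) ∧ ∀ s, |s| < ε → Φ s = ψ s := by
  have hpow : ∀ (n : ℕ) (s : ℝ), |n * s| < ε → ψ (n * s) = ψ s ^ n := by
    intro n
    induction n with
    | zero => intro s _; simp [h0]
    | succ n ih =>
      intro s hs
      push_cast at hs ⊢
      rw [abs_mul, abs_of_nonneg (by positivity)] at hs
      have hn : (0 : ℝ) ≤ n := by positivity
      have h1 : |(n : ℝ) * s| < ε := by
        rw [abs_mul, abs_of_nonneg hn]; nlinarith [abs_nonneg s]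
      have h2 : |s| < ε := by nlinarith [abs_nonneg s]
      have h3 : |(n : ℝ) * s + s| < ε := by
        rw [show (n : ℝ) * s + s = (n + 1) * s by ring, abs_mul, abs_of_nonneg (by positivity)]
        exact hs
      rw [show ((n : ℝ) + 1) * s = n * s + s by ring, h _ _ h1 h2 h3, ih s h1, pow_succ]
  let N : ℝ → ℕ := fun t => ⌊|t| / ε⌋₊ + 1
  have hN : ∀ t, |t / N t| < ε := by
    intro t
    have : |t| / ε < (N t : ℝ) := by simpa [N] using Nat.lt_floor_add_one (|t| / ε)
    have hNp : (0 : ℝ) < N t := by simp only [N]; positivity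
    rw [abs_div, abs_of_pos hNp, div_lt_iff₀ hNp]
    rw [div_lt_iff₀ hε] at this
    linarith
  have hind : ∀ (t : ℝ) (n m : ℕ), 0 < n → 0 < m → |t / n| < ε →
      ψ (t / n) ^ n = ψ (t / (n * m : ℕ)) ^ (n * m) := by
    intro t n m hn hm ht
    have hn' : (0 : ℝ) < n := by exact_mod_cast hn
    have hm' : (0 : ℝ) < m := by exact_mod_cast hm
    have e : t / n = m * (t / (n * m : ℕ)) := by push_cast; field_simp
    rw [mul_comm n m, pow_mul, mul_comm m n, ← hpow m _ (by rw [← e]; exact ht), ← e]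
  have key : ∀ (t : ℝ) (n : ℕ), 0 < n → |t / n| < ε → ψ (t / N t) ^ N t = ψ (t / n) ^ n := by
    intro t n hn ht
    rw [hind t (N t) n (Nat.succ_pos _) hn (hN t), hind t n (N t) hn (Nat.succ_pos _) ht,
      mul_comm n (N t)]
  refine ⟨fun t => ψ (t / N t) ^ N t, ?_, ?_⟩
  · intro s t
    obtain ⟨n, hn⟩ := exists_nat_gt ((|s| + |t|) / ε)
    have hn0 : (0 : ℝ) < n := lt_of_le_of_lt (by positivity) hn
    rw [div_lt_iff₀ hε] at hn
    have hb : ∀ u : ℝ, |u| ≤ |s| + |t| → |u / n| < ε := by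
      intro u hu
      rw [abs_div, abs_of_pos hn0, div_lt_iff₀ hn0]; linarith
    have hs := hb s (by linarith [abs_nonneg t])
    have ht := hb t (by linarith [abs_nonneg s])
    have hst := hb (s + t) (abs_add_le _ _)
    have hn1 : 0 < n := by exact_mod_cast hn0
    simp only
    rw [key _ n hn1 hs, key _ n hn1 ht, key _ n hn1 hst]
    have c1 : ψ ((s + t) / n) = ψ (s / n) * ψ (t / n) := by
      rw [add_div]; exact h _ _ hs ht (by rw [← add_div]; exact hst)
    have c2 : ψ ((s + t) / n) = ψ (t / n) * ψ (s / n) := by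
      rw [add_comm s t, add_div]; exact h _ _ ht hs (by rw [← add_div, add_comm]; exact hst)
    rw [c1, Commute.mul_pow]
    exact c1.symm.trans c2
  · intro s hs
    simp only
    rw [key s 1 one_pos (by simpa using hs)]; simp

theorem circle_of_flow {M : Type*} [TopologicalSpace M] [CompactSpace M] [T2Space M]
    (Φ : ℝ → M → M) (h0 : ∀ w, Φ 0 w = w) (hadd : ∀ s t w, Φ (s + t) w = Φ s (Φ t w))
    (hmap : ∀ w, map (fun s => Φ s w) (𝓝 0) = 𝓝 w)
    (hinj : ∀ w, ∀ᶠ s in 𝓝 (0 : ℝ), Φ s w = w → s = 0) (w : M) :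
    IsOpen (connectedComponent w) ∧ Nonempty (connectedComponent w ≃ₜ Circle) := by
  have hmapt : ∀ w t, map (fun s => Φ s w) (𝓝 t) = 𝓝 (Φ t w) := by
    intro w t
    rw [← hmap (Φ t w)]
    have : 𝓝 t = map (fun s => s + t) (𝓝 0) := by
      rw [map_add_right_nhds]; simp
    rw [this, Filter.map_map]
    congr 1
    funext s
    exact hadd s t w
  have hcont : ∀ w, Continuous fun s => Φ s w := fun w =>
    continuous_iff_continuousAt.2 fun t => (hmapt w t).le
  have hopen : ∀ w, IsOpenMap fun s => Φ s w := fun w =>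
    IsOpenMap.of_nhds_le fun t => (hmapt w t).ge
  have hro : ∀ w, IsOpen (range fun s => Φ s w) := fun w => (hopen w).isOpen_range
  have hclosed : IsClosed (range fun s => Φ s w) := by
    rw [← isOpen_compl_iff, isOpen_iff_mem_nhds]
    intro v hv
    filter_upwards [(hro v).mem_nhds ⟨0, h0 v⟩]
    rintro _ ⟨s, rfl⟩ ⟨t, ht⟩
    apply hv
    refine ⟨-s + t, ?_⟩
    simp only at ht ⊢
    rw [hadd, ht, ← hadd]; simp [h0]
  have hcc : connectedComponent w = range fun s => Φ s w := by
    apply Subset.antisymm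
    · exact IsClopen.connectedComponent_subset ⟨hclosed, hro w⟩ ⟨0, h0 w⟩
    · exact (isPreconnected_range (hcont w)).subset_connectedComponent ⟨0, h0 w⟩
  rw [hcc]
  refine ⟨hro w, ?_⟩
  let H : AddSubgroup ℝ :=
    { carrier := {s | Φ s w = w}
      zero_mem' := h0 w
      add_mem' := by
        intro a b ha hb
        simp only [mem_ofPred_eq] at *
        rw [hadd, hb, ha]
      neg_mem' := by
        intro a ha
        simp only [mem_ofPred_eq] at *
        conv_lhs => rw [← ha]
        rw [← hadd]; simp [h0] }
  have hHmem : ∀ s, s ∈ H ↔ Φ s w = w := fun s => Iff.rfl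
  obtain ⟨a, ha, hball⟩ := Metric.eventually_nhds_iff.1 (hinj w)
  obtain ⟨b, hb⟩ := AddSubgroup.cyclic_of_isolated_zero (H := H) ha (by
    rw [Set.disjoint_left]
    intro s hs hs'
    have := hball (y := s) (by simp [abs_lt]; constructor <;> linarith [hs'.1, hs'.2]) hs
    exact hs'.1.ne' this)
  rw [← AddSubgroup.zmultiples_eq_closure] at hb
  let o : ℝ → range (fun s => Φ s w) := fun s => ⟨Φ s w, s, rfl⟩
  have hoc : Continuous o := (hcont w).subtype_mk _
  have hoo : IsOpenMap o := by
    intro V hV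
    have := (hopen w) V hV
    have e : o '' V = Subtype.val ⁻¹' ((fun s => Φ s w) '' V) := by
      ext ⟨x, hx⟩
      simp [o, Subtype.ext_iff]
    rw [e]
    exact this.preimage continuous_subtype_val
  have hos : Function.Surjective o := by
    rintro ⟨_, s, rfl⟩; exact ⟨s, rfl⟩
  have hoeq : ∀ s t, o s = o t ↔ -s + t ∈ AddSubgroup.zmultiples b := by
    intro s t
    rw [← hb, hHmem, hadd]
    rw [Subtype.ext_iff]
    change Φ s w = Φ t w ↔ _
    constructor
    · intro h; rw [← h, ← hadd]; simp [h0]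
    · intro h; conv_lhs => rw [← h]
      rw [← hadd]; simp [h0]
  let q : AddCircle b → range (fun s => Φ s w) :=
    Quotient.lift o (by
      intro s t hst
      exact (hoeq s t).2 (QuotientAddGroup.leftRel_apply.1 hst))
  have hqc : Continuous q := Continuous.quotient_lift hoc _
  have hqo : IsOpenMap q := by
    intro V hV
    have : q '' V = o '' ((fun x : ℝ => (x : AddCircle b)) ⁻¹' V) := by
      ext x
      constructor
      · rintro ⟨y, hy, rfl⟩
        induction y using QuotientAddGroup.induction_on with
        | H z => exact ⟨z, hy, rfl⟩
      · rintro ⟨z, hz, rfl⟩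
        exact ⟨_, hz, rfl⟩
    rw [this]
    exact hoo _ (hV.preimage (AddCircle.continuous_mk' b))
  have hqb : Function.Bijective q := by
    constructor
    · intro x y
      induction x using QuotientAddGroup.induction_on with
      | H s =>
      induction y using QuotientAddGroup.induction_on with
      | H t =>
      intro h
      exact QuotientAddGroup.eq.2 ((hoeq s t).1 h)
    · intro x
      obtain ⟨s, rfl⟩ := hos x
      exact ⟨(s : AddCircle b), rfl⟩
  let e : AddCircle b ≃ₜ range (fun s => Φ s w) :=
    (Equiv.ofBijective q hqb).toHomeomorphOfContinuousOpen hqc hqo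
  have hb0 : b ≠ 0 := by
    rintro rfl
    have : CompactSpace (range fun s => Φ s w) := isCompact_iff_compactSpace.1 hclosed.isCompact
    have : Function.Injective o := by
      intro s t h
      have := (hoeq s t).1 h
      simp at this
      linarith
    let e' : ℝ ≃ₜ range (fun s => Φ s w) :=
      (Equiv.ofBijective o ⟨this, hos⟩).toHomeomorphOfContinuousOpen hoc hoo
    have : CompactSpace ℝ := e'.symm.compactSpace
    exact noncompact_univ ℝ isCompact_univ
  exact ⟨e.symm.trans (AddCircle.homeomorphCircle hb0)⟩

/-- The Hamiltonian vector field of `g`. -/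
noncomputable def hamX (g : ℝ × ℝ → ℝ) (q : ℝ × ℝ) : ℝ × ℝ :=
  (-(fderiv ℝ g q (0, 1)), fderiv ℝ g q (1, 0))

theorem clm_expand (L : ℝ × ℝ →L[ℝ] ℝ) (v : ℝ × ℝ) : L v = v.1 * L (1, 0) + v.2 * L (0, 1) := by
  have : v = v.1 • ((1 : ℝ), (0 : ℝ)) + v.2 • ((0 : ℝ), (1 : ℝ)) := by
    ext <;> simp
  conv_lhs => rw [this]
  simp only [map_add, map_smul, smul_eq_mul]

theorem local_time (g : ℝ × ℝ → ℝ) (Ω : Set (ℝ × ℝ)) (hΩ : IsOpen Ω) (hg : ContDiffOn ℝ 1 g Ω)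
    (p : ℝ × ℝ) (hp : p ∈ Ω) (hgp : g p = 0) (hd : fderiv ℝ g p ≠ 0) :
    ∃ (τ : ℝ × ℝ → ℝ) (c : ℝ → ℝ × ℝ), τ p = 0 ∧ c 0 = p ∧
      (∀ᶠ q in 𝓝 p, q ∈ Ω → g q = 0 →
        c (τ q) = q ∧ ∃ D : ℝ × ℝ →L[ℝ] ℝ, HasFDerivAt τ D q ∧ D (hamX g q) = 1) ∧
      (∀ᶠ t in 𝓝 (0 : ℝ), c t ∈ Ω ∧ g (c t) = 0 ∧ τ (c t) = t ∧
        HasDerivAt c (hamX g (c t)) t) := by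
  have hgAt : ∀ q ∈ Ω, ContDiffAt ℝ 1 g q := fun q hq => hg.contDiffAt (hΩ.mem_nhds hq)
  have hXc : ContinuousOn (hamX g) Ω := by
    have h1 : ContinuousOn (fderiv ℝ g) Ω := hg.continuousOn_fderiv_of_isOpen hΩ le_rfl
    exact ((h1.clm_apply continuousOn_const).neg).prodMk (h1.clm_apply continuousOn_const)
  set P := hamX g p with hP
  let ℓ : ℝ × ℝ →L[ℝ] ℝ :=
    P.1 • ContinuousLinearMap.fst ℝ ℝ ℝ + P.2 • ContinuousLinearMap.snd ℝ ℝ ℝ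
  have hℓ : ∀ v, ℓ v = P.1 * v.1 + P.2 * v.2 := fun v => by simp [ℓ]
  have hPne : 0 < P.1 ^ 2 + P.2 ^ 2 := by
    by_contra hcon
    have h1 : P.1 = 0 := by nlinarith [sq_nonneg P.1, sq_nonneg P.2]
    have h2 : P.2 = 0 := by nlinarith [sq_nonneg P.1, sq_nonneg P.2]
    apply hd
    ext
    · simpa [hP, hamX] using h2
    · simpa [hP, hamX] using h1
  have hℓP : 0 < ℓ (hamX g p) := by rw [hℓ, ← hP]; nlinarith
  -- the straightening map
  let H : ℝ × ℝ → ℝ × ℝ := fun q => (ℓ q, g q)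
  have hH : ContDiffAt ℝ 1 H p := ℓ.contDiff.contDiffAt.prodMk (hgAt p hp)
  let L : ℝ × ℝ →L[ℝ] ℝ × ℝ := ℓ.prod (fderiv ℝ g p)
  have hLinj : Function.Injective L := by
    rw [injective_iff_map_eq_zero]
    intro v hv
    have h1 : ℓ v = 0 := congrArg Prod.fst hv
    have h2 : fderiv ℝ g p v = 0 := congrArg Prod.snd hv
    rw [hℓ] at h1
    rw [clm_expand] at h2
    have e1 : fderiv ℝ g p (1, 0) = P.2 := rfl
    have e2 : fderiv ℝ g p (0, 1) = -P.1 := by simp [hP, hamX]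
    rw [e1, e2] at h2
    have k1 : (P.1 ^ 2 + P.2 ^ 2) * v.1 = 0 := by linear_combination P.1 * h1 + P.2 * h2
    have k2 : (P.1 ^ 2 + P.2 ^ 2) * v.2 = 0 := by linear_combination P.2 * h1 - P.1 * h2
    ext
    · simpa [hPne.ne'] using k1
    · simpa [hPne.ne'] using k2
  let Le : (ℝ × ℝ) ≃L[ℝ] ℝ × ℝ :=
    (LinearEquiv.ofInjectiveEndo (L : ℝ × ℝ →ₗ[ℝ] ℝ × ℝ) hLinj).toContinuousLinearEquiv
  have hLe : (Le : ℝ × ℝ →L[ℝ] ℝ × ℝ) = L := by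
    apply ContinuousLinearMap.ext; intro v; rfl
  have hH' : HasFDerivAt H (Le : ℝ × ℝ →L[ℝ] ℝ × ℝ) p := by
    rw [hLe]
    exact ℓ.hasFDerivAt.prodMk ((hgAt p hp).differentiableAt one_ne_zero).hasFDerivAt
  let Ψ := hH.toOpenPartialHomeomorph H hH' one_ne_zero
  have hΨc : ∀ q, Ψ q = H q := fun q => rfl
  have hpS : p ∈ Ψ.source := hH.mem_toOpenPartialHomeomorph_source hH' one_ne_zero
  set u₀ := ℓ p with hu₀
  have hHp : H p = (u₀, 0) := by simp [H, hgp, hu₀]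
  let c₀ : ℝ → ℝ × ℝ := fun u => Ψ.symm (u, 0)
  have hc₀u : c₀ u₀ = p := by
    simp only [c₀]; rw [← hHp, ← hΨc]; exact Ψ.left_inv hpS
  have hKcd : ContDiffAt ℝ 1 Ψ.symm (u₀, 0) := by
    have := hH.to_localInverse hH' one_ne_zero
    rw [hHp] at this
    exact this
  have hc₀cd : ContDiffAt ℝ 1 c₀ u₀ := by
    have h1 : ContDiffAt ℝ 1 (fun u : ℝ => (u, (0 : ℝ))) u₀ := by fun_prop
    exact ContDiffAt.comp u₀ hKcd h1
  have hpT : (u₀, (0 : ℝ)) ∈ Ψ.target := by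
    rw [← hHp, ← hΨc]; exact Ψ.map_source hpS
  -- properties holding near `u₀`
  have hev1 : ∀ᶠ u in 𝓝 u₀, ContDiffAt ℝ 1 c₀ u := hc₀cd.eventually (by simp)
  have hev2 : ∀ᶠ u in 𝓝 u₀, (u, (0 : ℝ)) ∈ Ψ.target :=
    (by fun_prop : Continuous fun u : ℝ => (u, (0 : ℝ))).continuousAt.eventually
      (Ψ.open_target.mem_nhds hpT)
  have hev3 : ∀ᶠ u in 𝓝 u₀, c₀ u ∈ Ω := by
    apply hc₀cd.continuousAt.eventually
    rw [hc₀u]; exact hΩ.mem_nhds hp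
  have hℓX : ∀ᶠ q in 𝓝 p, 0 < ℓ (hamX g q) := by
    have : ContinuousAt (fun q => ℓ (hamX g q)) p :=
      ℓ.continuous.continuousAt.comp (hXc.continuousAt (hΩ.mem_nhds hp))
    exact this.eventually (lt_mem_nhds hℓP)
  have hev4 : ∀ᶠ u in 𝓝 u₀, 0 < ℓ (hamX g (c₀ u)) := by
    apply hc₀cd.continuousAt.eventually (p := fun q => 0 < ℓ (hamX g q))
    rw [hc₀u]; exact hℓX
  have hHc : ∀ᶠ u in 𝓝 u₀, H (c₀ u) = (u, 0) := by
    filter_upwards [hev2] with u hu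
    exact Ψ.right_inv hu
  let k : ℝ → ℝ := fun u => (ℓ (hamX g (c₀ u)))⁻¹
  obtain ⟨δ, hδ, hball⟩ := Metric.eventually_nhds_iff_ball.1
    (hev1.and (hev3.and (hev4.and hHc)))
  set B := Metric.ball u₀ δ with hB
  have hkc : ∀ u ∈ B, ContinuousAt k u := by
    intro u hu
    obtain ⟨h1, h3, h4, -⟩ := hball u hu
    have hcc : ContinuousAt (fun u => ℓ (hamX g (c₀ u))) u := ℓ.continuous.continuousAt.comp
      (ContinuousAt.comp (hXc.continuousAt (hΩ.mem_nhds h3)) h1.continuousAt)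
    exact hcc.inv₀ h4.ne'
  have hkco : ContinuousOn k B := fun u hu => (hkc u hu).continuousWithinAt
  have hu₀B : u₀ ∈ B := Metric.mem_ball_self hδ
  have hBo : IsOpen B := Metric.isOpen_ball
  have hBconv : Convex ℝ B := convex_ball u₀ δ
  let T : ℝ → ℝ := fun u => ∫ s in u₀..u, k s
  have hT : ∀ u ∈ B, HasDerivAt T (k u) u := by
    intro u hu
    have hsub : uIcc u₀ u ⊆ B := by
      rw [← segment_eq_uIcc]; exact hBconv.segment_subset hu₀B hu
    apply intervalIntegral.integral_hasDerivAt_right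
    · exact (hkco.mono hsub).intervalIntegrable
    · exact hkco.stronglyMeasurableAtFilter hBo u hu
    · exact hkc u hu
  have hTs : HasStrictDerivAt T (k u₀) u₀ := by
    apply hasStrictDerivAt_of_hasDerivAt_of_continuousAt _ (hkc u₀ hu₀B)
    filter_upwards [hBo.mem_nhds hu₀B] with u hu using hT u hu
  have hkne : ∀ u ∈ B, k u ≠ 0 := fun u hu => inv_ne_zero (hball u hu).2.2.1.ne'
  have hTs' := hTs.hasStrictFDerivAt_equiv (hkne u₀ hu₀B)
  let e := hTs'.toOpenPartialHomeomorph T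
  have heT : ∀ u, e u = T u := fun u => rfl
  have hu₀e : u₀ ∈ e.source := hTs'.mem_toOpenPartialHomeomorph_source
  have hT0 : T u₀ = 0 := by simp [T]
  have h0e : (0 : ℝ) ∈ e.target := by
    rw [← hT0, ← heT]; exact e.map_source hu₀e
  have hes0 : e.symm 0 = u₀ := by
    rw [← hT0, ← heT]; exact e.left_inv hu₀e
  have hℓc : Tendsto ℓ (𝓝 p) (𝓝 u₀) := ℓ.continuous.continuousAt
  refine ⟨fun q => T (ℓ q), fun t => c₀ (e.symm t), hT0, ?_, ?_, ?_⟩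
  · simp only; rw [hes0, hc₀u]
  · filter_upwards [Ψ.open_source.mem_nhds hpS, hℓc.eventually (e.open_source.mem_nhds hu₀e),
      hℓc.eventually (hBo.mem_nhds hu₀B), hℓX] with q hq1 hq2 hq3 hq4 hqΩ hq0
    have hcq : c₀ (ℓ q) = q := by
      have : (ℓ q, (0 : ℝ)) = Ψ q := by rw [hΨc]; simp [H, hq0]
      simp only [c₀]; rw [this]; exact Ψ.left_inv hq1
    refine ⟨?_, k (ℓ q) • ℓ, ?_, ?_⟩
    · rw [← heT, e.left_inv hq2, hcq]
    · exact (hT _ hq3).comp_hasFDerivAt q ℓ.hasFDerivAt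
    · simp only [k, hcq, _root_.smul_apply, smul_eq_mul]
      exact inv_mul_cancel₀ hq4.ne'
  · have hesc : Tendsto e.symm (𝓝 0) (𝓝 u₀) := by
      have := e.symm.continuousAt (x := 0) h0e
      rwa [ContinuousAt, hes0] at this
    filter_upwards [e.open_target.mem_nhds h0e, hesc.eventually (hBo.mem_nhds hu₀B)] with t ht hu
    set u := e.symm t with hu_def
    obtain ⟨h1, h3, h4, h5⟩ := hball u hu
    have h6 : ℓ (c₀ u) = u := congrArg Prod.fst h5
    have h7 : g (c₀ u) = 0 := congrArg Prod.snd h5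
    refine ⟨h3, h7, ?_, ?_⟩
    · rw [h6, ← heT]; exact e.right_inv ht
    · have hes : HasDerivAt e.symm (k u)⁻¹ t := e.hasDerivAt_symm ht (hkne u hu) (hT u hu)
      have hc' : HasDerivAt c₀ (deriv c₀ u) u := (h1.differentiableAt one_ne_zero).hasDerivAt
      set v := deriv c₀ u with hv
      have hBn : B ∈ 𝓝 u := hBo.mem_nhds hu
      have hℓv : ℓ v = 1 := by
        have d1 : HasDerivAt (fun s => ℓ (c₀ s)) (ℓ v) u := ℓ.hasFDerivAt.comp_hasDerivAt u hc'
        have d2 : HasDerivAt (fun s => ℓ (c₀ s)) 1 u := by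
          apply (hasDerivAt_id u).congr_of_eventuallyEq
          filter_upwards [hBn] with s hs
          exact congrArg Prod.fst (hball s hs).2.2.2
        exact d1.unique d2
      have hgv : fderiv ℝ g (c₀ u) v = 0 := by
        have d1 : HasDerivAt (fun s => g (c₀ s)) (fderiv ℝ g (c₀ u) v) u :=
          ((hgAt _ h3).differentiableAt one_ne_zero).hasFDerivAt.comp_hasDerivAt u hc'
        have d2 : HasDerivAt (fun s => g (c₀ s)) 0 u := by
          apply (hasDerivAt_const u (0 : ℝ)).congr_of_eventuallyEq
          filter_upwards [hBn] with s hs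
          exact congrArg Prod.snd (hball s hs).2.2.2
        exact d1.unique d2
      have hcomp := hc'.scomp t hes
      have : (k u)⁻¹ • v = hamX g (c₀ u) := by
        simp only [k, inv_inv]
        rw [hℓ] at hℓv ⊢
        rw [clm_expand] at hgv
        have e1 : fderiv ℝ g (c₀ u) (1, 0) = (hamX g (c₀ u)).2 := rfl
        have e2 : fderiv ℝ g (c₀ u) (0, 1) = -(hamX g (c₀ u)).1 := by simp [hamX]
        rw [e1, e2] at hgv
        set Y := hamX g (c₀ u)
        ext
        · simp only [Prod.smul_fst, smul_eq_mul]
          linear_combination P.2 * hgv + Y.1 * hℓv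
        · simp only [Prod.smul_snd, smul_eq_mul]
          linear_combination (-P.1) * hgv + Y.2 * hℓv
      rw [this] at hcomp
      exact hcomp

/-- `γ` is, at time `t`, an integral curve of the Hamiltonian field inside the zero set. -/
def IsSol (g : ℝ × ℝ → ℝ) (Ω : Set (ℝ × ℝ)) (γ : ℝ → ℝ × ℝ) (t : ℝ) : Prop :=
  γ t ∈ Ω ∧ g (γ t) = 0 ∧ HasDerivAt γ (hamX g (γ t)) t

theorem sol_unique (g : ℝ × ℝ → ℝ) (Ω : Set (ℝ × ℝ)) (hΩ : IsOpen Ω) (hg : ContDiffOn ℝ 1 g Ω)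
    (hreg : ∀ p ∈ Ω, g p = 0 → fderiv ℝ g p ≠ 0) (I : Set ℝ) (hI : IsOpen I)
    (hIc : IsPreconnected I) (γ₁ γ₂ : ℝ → ℝ × ℝ) (h₁ : ∀ t ∈ I, IsSol g Ω γ₁ t)
    (h₂ : ∀ t ∈ I, IsSol g Ω γ₂ t) (t₀ : ℝ) (ht₀ : t₀ ∈ I) (he : γ₁ t₀ = γ₂ t₀) :
    ∀ t ∈ I, γ₁ t = γ₂ t := by
  have hloc : ∀ t ∈ I, γ₁ t = γ₂ t → ∀ᶠ s in 𝓝 t, γ₁ s = γ₂ s := by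
    intro t ht hte
    obtain ⟨τ, c, -, -, hτ, -⟩ :=
      local_time g Ω hΩ hg (γ₁ t) (h₁ t ht).1 (h₁ t ht).2.1 (hreg _ (h₁ t ht).1 (h₁ t ht).2.1)
    have c1 := (h₁ t ht).2.2.continuousAt.eventually hτ
    have c2 := (h₂ t ht).2.2.continuousAt.eventually (hte ▸ hτ)
    obtain ⟨δ, hδ, hb⟩ := Metric.eventually_nhds_iff_ball.1 ((hI.eventually_mem ht).and (c1.and c2))
    have hder : ∀ s ∈ Metric.ball t δ, HasDerivAt (fun s => τ (γ₁ s) - τ (γ₂ s)) 0 s := by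
      intro s hs
      obtain ⟨hsI, k1, k2⟩ := hb s hs
      obtain ⟨-, D1, hD1, hD1'⟩ := k1 (h₁ s hsI).1 (h₁ s hsI).2.1
      obtain ⟨-, D2, hD2, hD2'⟩ := k2 (h₂ s hsI).1 (h₂ s hsI).2.1
      have a1 := hD1.comp_hasDerivAt s (h₁ s hsI).2.2
      have a2 := hD2.comp_hasDerivAt s (h₂ s hsI).2.2
      rw [hD1'] at a1
      rw [hD2'] at a2
      have a3 := a1.sub a2
      rw [sub_self] at a3
      exact a3
    filter_upwards [Metric.ball_mem_nhds t hδ] with s hs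
    have := Metric.isOpen_ball.is_const_of_deriv_eq_zero (convex_ball t δ).isPreconnected
      (fun s hs => (hder s hs).differentiableAt.differentiableWithinAt)
      (fun s hs => (hder s hs).deriv) hs (Metric.mem_ball_self hδ)
    simp only [hte, sub_self] at this
    obtain ⟨hsI, k1, k2⟩ := hb s hs
    have b1 := (k1 (h₁ s hsI).1 (h₁ s hsI).2.1).1
    have b2 := (k2 (h₂ s hsI).1 (h₂ s hsI).2.1).1
    rw [← b1, ← b2, sub_eq_zero.1 this]
  let u : Set ℝ := {t | ∀ᶠ s in 𝓝 t, γ₁ s = γ₂ s}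
  let v : Set ℝ := {t | ∀ᶠ s in 𝓝 t, γ₁ s ≠ γ₂ s}
  have hu : IsOpen u := isOpen_setOfPred_eventually_nhds
  have hv : IsOpen v := isOpen_setOfPred_eventually_nhds
  have huv : Disjoint u v := by
    rw [Set.disjoint_left]
    intro t h1 h2
    exact h2.self_of_nhds h1.self_of_nhds
  have hsub : I ⊆ u ∪ v := by
    intro t ht
    by_cases hte : γ₁ t = γ₂ t
    · exact Or.inl (hloc t ht hte)
    · exact Or.inr (((h₁ t ht).2.2.continuousAt.prodMk
        (h₂ t ht).2.2.continuousAt).eventually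
        (isClosed_diagonal.isOpen_compl.mem_nhds (by simpa using hte)))
  have := hIc.subset_left_of_subset_union hu hv huv hsub ⟨t₀, ht₀, hloc t₀ ht₀ he⟩
  intro t ht
  exact (this ht).self_of_nhds

/-- Translation by an integer in the first coordinate. -/
def trn (n : ℤ) (p : ℝ × ℝ) : ℝ × ℝ := p + ((n : ℝ), (0 : ℝ))

theorem trn_zero (p : ℝ × ℝ) : trn 0 p = p := by
  ext <;> simp [trn]

theorem covProj_eq_iff (p q : ℝ × ℝ) : covProj p = covProj q ↔ ∃ n : ℤ, p = trn n q := by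
  unfold covProj trn
  rw [Prod.mk.injEq]
  constructor
  · rintro ⟨h1, h2⟩
    have := QuotientAddGroup.eq.1 h1.symm
    obtain ⟨n, hn⟩ := AddSubgroup.mem_zmultiples_iff.1 this
    refine ⟨n, ?_⟩
    simp at hn
    ext
    · simp; linarith
    · simp [h2]
  · rintro ⟨n, rfl⟩
    constructor
    · apply Eq.symm
      apply QuotientAddGroup.eq.2
      rw [AddSubgroup.mem_zmultiples_iff]
      exact ⟨n, by simp⟩
    · simp

theorem covProj_trn (n : ℤ) (p : ℝ × ℝ) : covProj (trn n p) = covProj p :=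
  (covProj_eq_iff _ _).2 ⟨n, rfl⟩

theorem covProj_continuous : Continuous covProj :=
  ((AddCircle.continuous_mk' (1 : ℝ)).comp continuous_fst).prodMk continuous_snd

theorem covProj_isOpenMap : IsOpenMap covProj := by
  have h : IsOpenMap (fun x : ℝ => (x : AddCircle (1 : ℝ))) := QuotientAddGroup.isOpenMap_coe
  exact h.prodMap IsOpenMap.id

section
variable (g : ℝ × ℝ → ℝ) (Ω : Set (ℝ × ℝ))

theorem hamX_trn (hΩ : IsOpen Ω) (hper : ∀ (n : ℤ), ∀ p ∈ Ω, g (trn n p) = g p)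
    (n : ℤ) (p : ℝ × ℝ) (hp : p ∈ Ω) : hamX g (trn n p) = hamX g p := by
  have h : fderiv ℝ g (trn n p) = fderiv ℝ g p := by
    have e : (fun q => g (q + ((n : ℝ), (0 : ℝ)))) =ᶠ[𝓝 p] g := by
      filter_upwards [hΩ.mem_nhds hp] with q hq using hper n q hq
    rw [← e.fderiv_eq, fderiv_comp_add_right]
    rfl
  simp only [hamX, h]

theorem sol_trn (hΩ : IsOpen Ω) (hper : ∀ (n : ℤ), ∀ p ∈ Ω, g (trn n p) = g p)
    (hΩper : ∀ (n : ℤ), ∀ p ∈ Ω, trn n p ∈ Ω)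
    (n : ℤ) (γ : ℝ → ℝ × ℝ) (t : ℝ) (h : IsSol g Ω γ t) : IsSol g Ω (fun t => trn n (γ t)) t := by
  refine ⟨hΩper n _ h.1, (hper n _ h.1).trans h.2.1, ?_⟩
  simp only
  rw [hamX_trn g Ω hΩ hper n _ h.1]
  exact h.2.2.add_const _

theorem sol_shift (γ : ℝ → ℝ × ℝ) (t a : ℝ) (h : IsSol g Ω γ (t + a)) :
    IsSol g Ω (fun t => γ (t + a)) t :=
  ⟨h.1, h.2.1, HasDerivAt.comp_add_const t a h.2.2⟩

theorem uniform_exist (hΩ : IsOpen Ω) (hg : ContDiffOn ℝ 1 g Ω)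
    (hreg : ∀ p ∈ Ω, g p = 0 → fderiv ℝ g p ≠ 0)
    (hper : ∀ (n : ℤ), ∀ p ∈ Ω, g (trn n p) = g p)
    (hΩper : ∀ (n : ℤ), ∀ p ∈ Ω, trn n p ∈ Ω)
    (hK : IsCompact {p | p ∈ Ω ∧ g p = 0 ∧ p.1 ∈ Icc (0 : ℝ) 1}) :
    ∃ ε > 0, ∀ q ∈ Ω, g q = 0 → ∃ γ : ℝ → ℝ × ℝ, γ 0 = q ∧ ∀ t, |t| < ε → IsSol g Ω γ t := by
  have : ∃ ε > 0, ∀ q ∈ {p | p ∈ Ω ∧ g p = 0 ∧ p.1 ∈ Icc (0 : ℝ) 1},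
      q ∈ Ω → g q = 0 → ∃ γ : ℝ → ℝ × ℝ, γ 0 = q ∧ ∀ t, |t| < ε → IsSol g Ω γ t := by
    refine hK.induction_on (p := fun s => ∃ ε > 0, ∀ q ∈ s,
      q ∈ Ω → g q = 0 → ∃ γ : ℝ → ℝ × ℝ, γ 0 = q ∧ ∀ t, |t| < ε → IsSol g Ω γ t) ?_ ?_ ?_ ?_
    · exact ⟨1, one_pos, by simp⟩
    · rintro s t hst ⟨ε, hε, h⟩
      exact ⟨ε, hε, fun q hq => h q (hst hq)⟩
    · rintro s t ⟨ε, hε, h⟩ ⟨ε', hε', h'⟩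
      refine ⟨min ε ε', lt_min hε hε', ?_⟩
      rintro q (hq | hq) h1 h2
      · obtain ⟨γ, h0, hγ⟩ := h q hq h1 h2
        exact ⟨γ, h0, fun t ht => hγ t (ht.trans_le (min_le_left _ _))⟩
      · obtain ⟨γ, h0, hγ⟩ := h' q hq h1 h2
        exact ⟨γ, h0, fun t ht => hγ t (ht.trans_le (min_le_right _ _))⟩
    · rintro p ⟨hp, hgp, -⟩
      obtain ⟨τ, c, hτp, hcp, hτ, hc⟩ := local_time g Ω hΩ hg p hp hgp (hreg p hp hgp)
      obtain ⟨-, D, hD, -⟩ := hτ.self_of_nhds hp hgp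
      obtain ⟨δ, hδ, hb⟩ := Metric.eventually_nhds_iff.1 hc
      have hτc : ∀ᶠ q in 𝓝 p, |τ q| < δ / 2 := by
        have := hD.continuousAt.abs
        apply this.eventually (gt_mem_nhds _)
        simp [hτp, hδ]
      refine ⟨{q | |τ q| < δ / 2 ∧ (q ∈ Ω → g q = 0 → c (τ q) = q)}, ?_, δ / 2, by positivity, ?_⟩
      · apply mem_nhdsWithin_of_mem_nhds
        filter_upwards [hτc, hτ] with q h1 h2
        exact ⟨h1, fun a b => (h2 a b).1⟩
      · rintro q ⟨h1, h2⟩ hq hgq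
        refine ⟨fun t => c (t + τ q), by simp [h2 hq hgq], fun t ht => ?_⟩
        apply sol_shift
        have := hb (y := t + τ q) (by
          rw [Real.dist_eq, sub_zero]; linarith [abs_add_le t (τ q)])
        exact ⟨this.1, this.2.1, this.2.2.2⟩
  obtain ⟨ε, hε, h⟩ := this
  refine ⟨ε, hε, fun q hq hgq => ?_⟩
  have hf : q.1 + ((-⌊q.1⌋ : ℤ) : ℝ) = Int.fract q.1 := by
    rw [Int.fract]; push_cast; ring
  have a1 := hΩper (-⌊q.1⌋) q hq
  have a2 := (hper (-⌊q.1⌋) q hq).trans hgq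
  obtain ⟨γ, h0, hγ⟩ := h (trn (-⌊q.1⌋) q) ⟨a1, a2, by
    change q.1 + ((-⌊q.1⌋ : ℤ) : ℝ) ∈ _
    rw [hf]
    exact ⟨Int.fract_nonneg _, (Int.fract_lt_one _).le⟩⟩ a1 a2
  refine ⟨fun t => trn ⌊q.1⌋ (γ t), ?_, fun t ht => sol_trn g Ω hΩ hper hΩper _ _ _ (hγ t ht)⟩
  simp only [h0, trn]
  ext <;> simp

end

theorem components_of_periodic (g : ℝ × ℝ → ℝ) (Ω : Set (ℝ × ℝ)) (Z : Set Cyl)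
    (hΩ : IsOpen Ω) (hg : ContDiffOn ℝ 1 g Ω)
    (hreg : ∀ p ∈ Ω, g p = 0 → fderiv ℝ g p ≠ 0)
    (hper : ∀ (n : ℤ), ∀ p ∈ Ω, g (trn n p) = g p)
    (hΩper : ∀ (n : ℤ), ∀ p ∈ Ω, trn n p ∈ Ω)
    (hK : IsCompact {p | p ∈ Ω ∧ g p = 0 ∧ p.1 ∈ Icc (0 : ℝ) 1})
    (hZ : Z = covProj '' {p | p ∈ Ω ∧ g p = 0}) (hZc : IsCompact Z) (w : Z) :
    IsOpen (connectedComponent w) ∧ Nonempty (connectedComponent w ≃ₜ Circle) := by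
  obtain ⟨ε, hε, hex⟩ := uniform_exist g Ω hΩ hg hreg hper hΩper hK
  have hZmem : ∀ p, covProj p ∈ Z → p ∈ Ω ∧ g p = 0 := by
    intro p hp
    rw [hZ] at hp
    obtain ⟨q, ⟨hq, hgq⟩, e⟩ := hp
    obtain ⟨n, rfl⟩ := (covProj_eq_iff p q).1 e.symm
    exact ⟨hΩper n q hq, (hper n q hq).trans hgq⟩
  have hZmem' : ∀ p ∈ Ω, g p = 0 → covProj p ∈ Z := by
    intro p h1 h2; rw [hZ]; exact ⟨p, ⟨h1, h2⟩, rfl⟩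
  let R : ℝ → Cyl → Cyl → Prop := fun s z v => ∃ γ : ℝ → ℝ × ℝ,
    (∀ t, |t| < ε → IsSol g Ω γ t) ∧ covProj (γ 0) = z ∧ covProj (γ s) = v
  have hRex : ∀ s, |s| < ε → ∀ z : Z, ∃ v : Z, R s z v := by
    rintro s hs ⟨z, hz⟩
    have hz' := hz
    rw [hZ] at hz'
    obtain ⟨p, ⟨hp, hgp⟩, rfl⟩ := hz'
    obtain ⟨γ, h0, hγ⟩ := hex p hp hgp
    exact ⟨⟨covProj (γ s), hZmem' _ (hγ s hs).1 (hγ s hs).2.1⟩, γ, hγ, by simp [h0], rfl⟩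
  have hRcomp : ∀ s t z v x, |s| < ε → |t| < ε → |s + t| < ε → R t z v → R s v x →
      ∀ y, R (s + t) z y → ∀ γ : ℝ → ℝ × ℝ, (∀ t, |t| < ε → IsSol g Ω γ t) →
        covProj (γ 0) = z → covProj (γ t) = v → covProj (γ (s + t)) = x := by
    rintro s t z v x hs ht hst - ⟨γ₂, h2, h20, h2s⟩ - - γ hγ h0 hγt
    obtain ⟨n, hn⟩ := (covProj_eq_iff (γ t) (γ₂ 0)).1 (hγt.trans h20.symm)
    have := sol_unique g Ω hΩ hg hreg (Ioo (-ε) ε ∩ Ioo (-ε - t) (ε - t))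
      (isOpen_Ioo.inter isOpen_Ioo) ((convex_Ioo _ _).inter (convex_Ioo _ _)).isPreconnected
      (fun r => γ (r + t)) (fun r => trn n (γ₂ r))
      (fun r hr => sol_shift g Ω γ r t (hγ _ (by
        rw [abs_lt]; constructor <;> linarith [hr.2.1, hr.2.2])))
      (fun r hr => sol_trn g Ω hΩ hper hΩper n γ₂ r (h2 _ (abs_lt.2 hr.1)))
      0 (by
        rw [abs_lt] at ht
        refine ⟨⟨?_, ?_⟩, ?_, ?_⟩ <;> linarith [ht.1, ht.2])
      (by simpa using hn) s (by
        rw [abs_lt] at hs hst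
        refine ⟨⟨?_, ?_⟩, ?_, ?_⟩ <;> linarith [hs.1, hs.2, hst.1, hst.2])
    rw [this, covProj_trn, h2s]
  have hRcomp' : ∀ s t z v x, |s| < ε → |t| < ε → |s + t| < ε → R t z v → R s v x →
      R (s + t) z x := by
    intro s t z v x hs ht hst h1 h2
    have h1' := h1
    obtain ⟨γ, hγ, h0, hγt⟩ := h1'
    exact ⟨γ, hγ, h0, hRcomp s t z v x hs ht hst h1 h2 _ ⟨γ, hγ, h0, rfl⟩ γ hγ h0 hγt⟩
  have hRuniq : ∀ s z v x, |s| < ε → R s z v → R s z x → v = x := by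
    rintro s z v x hs ⟨γ, hγ, h0, h1⟩ h2
    have := hRcomp s 0 z z x hs (by simpa using hε) (by simpa using hs) ⟨γ, hγ, h0, h0⟩ h2
      _ ⟨γ, hγ, h0, rfl⟩ γ hγ h0 h0
    rw [add_zero] at this
    exact h1.symm.trans this
  choose ψ₀ hψ₀ using hRex
  let ψ : ℝ → Function.End Z := fun s => if hs : |s| < ε then ψ₀ s hs else 1
  have hψ : ∀ s, |s| < ε → ∀ z : Z, R s z (ψ s z) := by
    intro s hs z
    have : ψ s = ψ₀ s hs := dif_pos hs
    rw [this]; exact hψ₀ s hs z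
  have hε0 : |(0 : ℝ)| < ε := by simpa using hε
  obtain ⟨Φ, hadd, hΦ⟩ := local_hom_ext ψ ε hε (by
    funext z
    apply Subtype.ext
    have h := hψ 0 hε0 z
    have h' := h
    obtain ⟨γ, hγ, h1, h2⟩ := h'
    exact hRuniq 0 z _ _ hε0 h ⟨γ, hγ, h1, h1⟩) (by
    intro s t hs ht hst
    funext z
    apply Subtype.ext
    exact hRuniq _ z _ _ hst (hψ _ hst z)
      (hRcomp' s t z (ψ t z) _ hs ht hst (hψ t ht z) (hψ s hs (ψ t z))))
  have hΦR : ∀ s, |s| < ε → ∀ z : Z, R s z (Φ s z) := by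
    intro s hs z; rw [hΦ s hs]; exact hψ s hs z
  have : CompactSpace Z := isCompact_iff_compactSpace.1 hZc
  -- local description of the flow
  have hlocal : ∀ z : Z, ∃ (p : ℝ × ℝ) (τ : ℝ × ℝ → ℝ) (c : ℝ → ℝ × ℝ), covProj p = z ∧
      p ∈ Ω ∧ g p = 0 ∧ τ p = 0 ∧ c 0 = p ∧ ContinuousAt τ p ∧ ContinuousAt c 0 ∧
      (∀ᶠ q in 𝓝 p, q ∈ Ω → g q = 0 → c (τ q) = q) ∧
      (∀ᶠ t in 𝓝 (0 : ℝ), τ (c t) = t) ∧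
      (∀ᶠ t in 𝓝 (0 : ℝ), (Φ t z : Cyl) = covProj (c t)) := by
    rintro ⟨z, hz⟩
    have hz' := hz
    rw [hZ] at hz'
    obtain ⟨p, ⟨hp, hgp⟩, rfl⟩ := hz'
    obtain ⟨τ, c, hτp, hcp, hτ, hc⟩ := local_time g Ω hΩ hg p hp hgp (hreg p hp hgp)
    obtain ⟨-, D, hD, -⟩ := hτ.self_of_nhds hp hgp
    refine ⟨p, τ, c, rfl, hp, hgp, hτp, hcp, hD.continuousAt,
      hc.self_of_nhds.2.2.2.continuousAt, ?_, ?_, ?_⟩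
    · filter_upwards [hτ] with q h a b using (h a b).1
    · filter_upwards [hc] with t h using h.2.2.1
    · obtain ⟨γ, h0, hγ⟩ := hex p hp hgp
      obtain ⟨δ, hδ, hb⟩ := Metric.eventually_nhds_iff_ball.1 hc
      have hm : 0 < min δ ε := lt_min hδ hε
      have heq := sol_unique g Ω hΩ hg hreg (Metric.ball 0 (min δ ε)) Metric.isOpen_ball
        (convex_ball _ _).isPreconnected γ c
        (fun t ht => hγ t (by
          have : |t| < min δ ε := by simpa using ht
          exact this.trans_le (min_le_right _ _)))
        (fun t ht => by
          have h := hb t (Metric.ball_subset_ball (min_le_left _ _) ht)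
          exact ⟨h.1, h.2.1, h.2.2.2⟩) 0 (Metric.mem_ball_self hm) (h0.trans hcp.symm)
      filter_upwards [Metric.ball_mem_nhds 0 hm] with t ht
      have ht' : |t| < ε := by
        have : |t| < min δ ε := by simpa using ht
        exact this.trans_le (min_le_right _ _)
      rw [← heq t ht]
      exact hRuniq t _ _ _ ht' (hΦR t ht' _) ⟨γ, hγ, by simp [h0], rfl⟩
  have hΦ0 : ∀ z, Φ 0 z = z := by
    intro z
    obtain ⟨p, τ, c, hpz, -, -, -, hc0, -, -, -, -, h⟩ := hlocal z
    apply Subtype.ext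
    rw [h.self_of_nhds, hc0, hpz]
  refine circle_of_flow (M := Z) Φ hΦ0 (fun s t z => by rw [hadd]; rfl) ?_ ?_ w
  · intro z
    obtain ⟨p, τ, c, hpz, hp, hgp, hτp, hc0, hτc, hcc, hcτ, hτc', hΦc⟩ := hlocal z
    apply le_antisymm
    · change Tendsto _ _ _
      rw [tendsto_subtype_rng]
      have h1 : Tendsto (fun t => covProj (c t)) (𝓝 0) (𝓝 (z : Cyl)) := by
        have := covProj_continuous.continuousAt.comp hcc
        rw [ContinuousAt] at this
        simpa [Function.comp_def, hc0, hpz] using this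
      exact h1.congr' (by filter_upwards [hΦc] with t ht using ht.symm)
    · intro S hS
      rw [mem_map] at hS
      have hτ0 : Tendsto τ (𝓝 p) (𝓝 0) := by rw [ContinuousAt, hτp] at hτc; exact hτc
      have hN := (hτ0.eventually hS).and ((hτ0.eventually hΦc).and hcτ)
      have hO := covProj_isOpenMap.image_mem_nhds hN
      rw [hpz] at hO
      have hO' := continuous_subtype_val.continuousAt.preimage_mem_nhds hO
      filter_upwards [hO']
      rintro ⟨z', hz'⟩ ⟨q, ⟨hq1, hq2, hq3⟩, hqz⟩
      simp only at hqz
      subst hqz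
      obtain ⟨a, b⟩ := hZmem q hz'
      have : Φ (τ q) z = ⟨covProj q, hz'⟩ := by
        apply Subtype.ext
        rw [hq2, hq3 a b]
      rw [← this]
      exact hq1
  · intro z
    obtain ⟨p, τ, c, hpz, hp, hgp, hτp, hc0, hτc, hcc, hcτ, hτc', hΦc⟩ := hlocal z
    have hnear : ∀ᶠ t in 𝓝 (0 : ℝ), dist (c t) p < 1 := by
      have : ∀ᶠ q in 𝓝 (c 0), dist q p < 1 := by
        rw [hc0]; exact Metric.ball_mem_nhds p one_pos
      exact hcc.eventually this
    filter_upwards [hnear, hΦc, hτc'] with s h1 h2 h3 h4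
    rw [h4, ← hpz] at h2
    obtain ⟨n, hn⟩ := (covProj_eq_iff _ _).1 h2.symm
    have hn0 : n = 0 := by
      rw [hn, trn, dist_self_add_left, Prod.norm_def] at h1
      have : |(n : ℝ)| < 1 := lt_of_le_of_lt (le_max_left _ _) h1
      have : |n| < 1 := by exact_mod_cast this
      exact Int.abs_lt_one_iff.1 this
    rw [← h3, hn, hn0, trn_zero, hτp]

/-- If `0` is a regular value of `F_φ` on `A`, then the zero set `Z = F_φ⁻¹(0) ⊆ A` is
compact, disjoint from both boundary circles, has finitely many connected components, and
each connected component is homeomorphic to the unit circle. -/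
theorem zero_set_components_are_circles
    (f : Cyl → Cyl) (F G : ℝ × ℝ → ℝ × ℝ)
    -- `F` is a lift of `f`: `π ∘ f̃ = f ∘ π`
    (hlift : ∀ p ∈ stripA, covProj (F p) = f (covProj p))
    -- equivariance of the lift: `f̃(x+1, y) = f̃(x, y) + (1, 0)`
    (hper : ∀ p ∈ stripA, F (p.1 + 1, p.2) = ((F p).1 + 1, (F p).2))
    -- `f` is a C¹ diffeomorphism (through its lift): C¹, bijective on the strip,
    -- with a C¹ inverse lift `G`
    (hFC1 : ContDiffOn ℝ 1 F stripA)
    (hFbij : Set.BijOn F stripA stripA)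
    (hGC1 : ContDiffOn ℝ 1 G stripA)
    (hGmaps : Set.MapsTo G stripA stripA)
    (hGF : ∀ p ∈ stripA, G (F p) = p)
    (hFG : ∀ p ∈ stripA, F (G p) = p)
    -- each boundary component is mapped to itself
    (hbdry0 : ∀ x : ℝ, (F (x, 0)).2 = 0)
    (hbdry1 : ∀ x : ℝ, (F (x, 1)).2 = 1)
    -- twist condition for the normalized lift
    (htwist0 : ∀ x : ℝ, (F (x, 0)).1 < x)
    (htwist1 : ∀ x : ℝ, x < (F (x, 1)).1)
    (φ : ℝ) (hφ : 0 < φ)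
    -- `0` is a regular value of `F_φ`
    (hreg : ∀ p ∈ stripA, Fphi F φ p = 0 → fderivWithin ℝ (Fphi F φ) stripA p ≠ 0) :
    IsCompact (zeroSetA F φ) ∧
    (∀ z ∈ zeroSetA F φ, z.2 ≠ 0 ∧ z.2 ≠ 1) ∧
    {C : Set Cyl | ∃ z ∈ zeroSetA F φ, C = connectedComponentIn (zeroSetA F φ) z}.Finite ∧
    (∀ z ∈ zeroSetA F φ,
      Nonempty (↥(connectedComponentIn (zeroSetA F φ) z) ≃ₜ Circle)) := by
  set g := Fphi F φ with hgdef
  let Ω : Set (ℝ × ℝ) := univ ×ˢ Ioo (0 : ℝ) 1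
  have hΩ : IsOpen Ω := isOpen_univ.prod isOpen_Ioo
  have hΩs : Ω ⊆ stripA := prod_mono_right Ioo_subset_Icc_self
  have hgs : ContDiffOn ℝ 1 g stripA := by
    have h1 : ContDiffOn ℝ 1 (fun p => (F p).1) stripA := contDiff_fst.comp_contDiffOn hFC1
    have h2 : ContDiffOn ℝ 1 (fun p => (F p).2) stripA := contDiff_snd.comp_contDiffOn hFC1
    exact (contDiffOn_const.mul (h1.sub contDiff_fst.contDiffOn)).sub
      (h2.sub contDiff_snd.contDiffOn)
  have hg : ContDiffOn ℝ 1 g Ω := hgs.mono hΩs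
  have hin : ∀ p ∈ stripA, g p = 0 → p ∈ Ω := by
    rintro ⟨x, y⟩ ⟨-, hy0, hy1⟩ h
    simp only at hy0 hy1
    refine ⟨mem_univ _, lt_of_le_of_ne hy0 ?_, lt_of_le_of_ne hy1 ?_⟩
    · rintro h'
      simp only at h'
      subst h'
      simp only [hgdef, Fphi, hbdry0] at h
      nlinarith [htwist0 x, mul_pos hφ (sub_pos.2 (htwist0 x))]
    · rintro h'
      simp only at h'
      subst h'
      simp only [hgdef, Fphi, hbdry1] at h
      nlinarith [htwist1 x, mul_pos hφ (sub_pos.2 (htwist1 x))]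
  have hsets : {p ∈ stripA | g p = 0} = {p | p ∈ Ω ∧ g p = 0} := by
    ext p
    exact ⟨fun h => ⟨hin p h.1 h.2, h.2⟩, fun h => ⟨hΩs h.1, h.2⟩⟩
  have hZ : zeroSetA F φ = covProj '' {p | p ∈ Ω ∧ g p = 0} := by
    rw [zeroSetA, ← hsets]
  have hreg' : ∀ p ∈ Ω, g p = 0 → fderiv ℝ g p ≠ 0 := by
    intro p hp h
    have := hreg p (hΩs hp) h
    rwa [fderivWithin_of_mem_nhds (mem_of_superset (hΩ.mem_nhds hp) hΩs)] at this
  have hΩper : ∀ (n : ℤ), ∀ p ∈ Ω, trn n p ∈ Ω := by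
    rintro n ⟨x, y⟩ ⟨-, h⟩
    exact ⟨mem_univ _, by simpa [trn] using h⟩
  have hper1 : ∀ p ∈ Ω, g (trn 1 p) = g p := by
    intro p hp
    have h := hper p (hΩs hp)
    have e : trn 1 p = (p.1 + 1, p.2) := by ext <;> simp [trn]
    simp only [hgdef, Fphi, e, h]
    ring
  have htrn : ∀ (m n : ℤ) p, trn m (trn n p) = trn (n + m) p := by
    intro m n p
    ext <;> simp [trn, add_assoc]
  have hperN : ∀ (n : ℕ), ∀ p ∈ Ω, g (trn n p) = g p := by
    intro n
    induction n with
    | zero => intro p _; rw [Nat.cast_zero, trn_zero]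
    | succ n ih =>
      intro p hp
      have : trn ((n + 1 : ℕ) : ℤ) p = trn 1 (trn n p) := by rw [htrn]; push_cast; rfl
      rw [this, hper1 _ (hΩper _ _ hp), ih p hp]
  have hperZ : ∀ (n : ℤ), ∀ p ∈ Ω, g (trn n p) = g p := by
    intro n p hp
    obtain ⟨m, rfl | rfl⟩ := n.eq_nat_or_neg
    · exact hperN m p hp
    · have := hperN m (trn (-m) p) (hΩper _ _ hp)
      rw [htrn] at this
      rw [← this, neg_add_cancel, trn_zero]
  have hK : IsCompact {p | p ∈ Ω ∧ g p = 0 ∧ p.1 ∈ Icc (0 : ℝ) 1} := by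
    have hc : IsCompact (Icc (0 : ℝ) 1 ×ˢ Icc (0 : ℝ) 1) := isCompact_Icc.prod isCompact_Icc
    have hsub : Icc (0 : ℝ) 1 ×ˢ Icc (0 : ℝ) 1 ⊆ stripA := prod_mono_left (subset_univ _)
    have hcl := (hgs.continuousOn.mono hsub).preimage_isClosed_of_isClosed hc.isClosed
      (isClosed_singleton (x := (0 : ℝ)))
    have := hc.of_isClosed_subset hcl inter_subset_left
    convert this using 1
    ext p
    constructor
    · rintro ⟨h1, h2, h3⟩
      exact ⟨⟨h3, (hΩs h1).2⟩, h2⟩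
    · rintro ⟨⟨h1, h2⟩, h3⟩
      exact ⟨hin p ⟨mem_univ _, h2⟩ h3, h3, h1⟩
  have hZc : IsCompact (zeroSetA F φ) := by
    have : zeroSetA F φ = covProj '' {p | p ∈ Ω ∧ g p = 0 ∧ p.1 ∈ Icc (0 : ℝ) 1} := by
      rw [hZ]
      apply Subset.antisymm
      · rintro _ ⟨q, ⟨hq, hgq⟩, rfl⟩
        refine ⟨trn (-⌊q.1⌋) q, ⟨hΩper _ _ hq, (hperZ _ _ hq).trans hgq, ?_⟩, covProj_trn _ _⟩
        have hf : (trn (-⌊q.1⌋) q).1 = Int.fract q.1 := by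
          change q.1 + ((-⌊q.1⌋ : ℤ) : ℝ) = _
          rw [Int.fract]; push_cast; ring
        rw [hf]
        exact ⟨Int.fract_nonneg _, (Int.fract_lt_one _).le⟩
      · rintro _ ⟨q, ⟨hq, hgq, -⟩, rfl⟩
        exact ⟨q, ⟨hq, hgq⟩, rfl⟩
    rw [this]
    exact hK.image covProj_continuous
  have main := components_of_periodic g Ω (zeroSetA F φ) hΩ hg hreg' hperZ hΩper hK hZ hZc
  have : CompactSpace (zeroSetA F φ) := isCompact_iff_compactSpace.1 hZc
  refine ⟨hZc, ?_, ?_, ?_⟩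
  · intro z hz
    rw [hZ] at hz
    obtain ⟨q, ⟨hq, -⟩, rfl⟩ := hz
    exact ⟨hq.2.1.ne', hq.2.2.ne⟩
  · obtain ⟨t, ht⟩ := isCompact_univ.elim_finite_subcover
      (fun w : zeroSetA F φ => connectedComponent w) (fun w => (main w).1)
      (fun w _ => mem_iUnion.2 ⟨w, mem_connectedComponent⟩)
    apply (t.finite_toSet.image
      (fun w : zeroSetA F φ => Subtype.val '' connectedComponent w)).subset
    rintro C ⟨z, hz, rfl⟩
    obtain ⟨w, hw⟩ := mem_iUnion.1 (ht (mem_univ (⟨z, hz⟩ : zeroSetA F φ)))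
    obtain ⟨hwt, hw⟩ := mem_iUnion.1 hw
    refine ⟨w, hwt, ?_⟩
    simp only
    rw [connectedComponentIn_eq_image hz, connectedComponent_eq hw]
  · intro z hz
    obtain ⟨e⟩ := (main ⟨z, hz⟩).2
    rw [connectedComponentIn_eq_image hz]
    exact ⟨(Topology.IsEmbedding.subtypeVal.homeomorphImage _).symm.trans e⟩
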